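/- Let h: L → M and g: N → M be morphisms of differential graded Lie algebras over ℂ. Then H_{(h,g)} = {(l, n, m(t,dt)) ∈ L × N × M[t,dt] : h(l) = e₁(m(t,dt)), g(n) = e₀(m(t,dt))} is a differential graded Lie subalgebra of the product DGLA L × N × M[t,dt], and the barycentric subdivision map H_{(h,g)} → H, (l, n, m(t,dt)) ↦ (l, n, m(t/2, dt), m((s+1)/2, ds)), where H = {(l, n, m₁(t,dt), m₂(s,ds)) ∈ L × N × M[t,dt] × M[s,ds] : h(l) = e₁(m₂), g(n) = e₀(m₁), e₁(m₁) = e₀(m₂)}, is an injective quasi-isomorphism of DGLAs. -/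

import Mathlib

noncomputable section

open TensorProduct

/-- Raw graded Lie data: a `ℤ`-graded complex vector space with a degree-one
differential and a degree-zero bracket (no axioms). -/
structure GLD where
  V : ℤ → Type
  [grp : ∀ i, AddCommGroup (V i)]
  [mod : ∀ i, Module ℂ (V i)]
  d : ∀ i, V i → V (i + 1)
  br : ∀ i j, V i → V j → V (i + j)

attribute [instance] GLD.grp GLD.mod

namespace GLD

/-- Transport along an equality of degrees. -/
def tr (L : GLD) {i j : ℤ} (h : i = j) (x : L.V i) : L.V j := h ▸ x

/-- The Maurer-Cartan equation in degree one: `dx + ½[x,x] = 0`. -/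
def MC1 (L : GLD) (x : L.V 1) : Prop :=
  L.d 1 x + (2 : ℂ)⁻¹ • L.br 1 1 x x = 0

/-- The adjoint action of a degree-zero element on degree one. -/
def ad01 (L : GLD) (a : L.V 0) (x : L.V 1) : L.V 1 := L.tr (by omega) (L.br 0 1 a x)

/-- The adjoint action of a degree-zero element on degree zero. -/
def ad00 (L : GLD) (a : L.V 0) (x : L.V 0) : L.V 0 := L.tr (by omega) (L.br 0 0 a x)

/-- The gauge action `e^a * x = x + Σ_{n≥0} ad_a^n/(n+1)! ([a,x] - da)`. -/
def gauge (L : GLD) (a : L.V 0) (x : L.V 1) : L.V 1 :=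
  x + ∑ᶠ n : ℕ, (((n+1).factorial : ℂ))⁻¹ •
    (L.ad01 a)^[n] (L.ad01 a x - L.tr (by omega) (L.d 0 a))

/-- Right-nested bracket of a word in two degree-zero letters `x` (true) and `y` (false). -/
def nest (L : GLD) (x y : L.V 0) : List Bool → L.V 0
  | [] => 0
  | [b] => if b then x else y
  | b :: (c :: rest) => L.ad00 (if b then x else y) (L.nest x y (c :: rest))

end GLD

/-- The word `x^{r₁} y^{s₁} ⋯ x^{r_n} y^{s_n}` encoded as a list of booleans. -/
def bchWord (P : List (ℕ × ℕ)) : List Bool :=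
  P.flatMap fun p => List.replicate p.1 true ++ List.replicate p.2 false

open Classical in
/-- The coefficient in Dynkin's formula for the Baker-Campbell-Hausdorff series. -/
def bchCoeff (P : List (ℕ × ℕ)) : ℂ :=
  if P = [] ∨ ¬ (∀ p ∈ P, 0 < p.1 + p.2) then 0 else
    (-1 : ℂ) ^ (P.length - 1) / (P.length : ℂ) *
      ((((P.map fun p => p.1 + p.2).sum : ℕ) : ℂ) *
        (((P.map fun p => (p.1.factorial * p.2.factorial : ℕ)).prod : ℕ) : ℂ))⁻¹

/-- The Baker-Campbell-Hausdorff product on degree-zero elements, via Dynkin's formula. -/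
def GLD.bch (L : GLD) (x y : L.V 0) : L.V 0 :=
  ∑ᶠ P : List (ℕ × ℕ), bchCoeff P • L.nest x y (bchWord P)

/-- Differential graded Lie algebra over `ℂ`. -/
structure DGLA extends GLD where
  d_add : ∀ i (x y : V i), d i (x + y) = d i x + d i y
  d_smul : ∀ i (c : ℂ) (x : V i), d i (c • x) = c • d i x
  br_add_left : ∀ i j (x x' : V i) (y : V j), br i j (x + x') y = br i j x y + br i j x' y
  br_smul_left : ∀ i j (c : ℂ) (x : V i) (y : V j), br i j (c • x) y = c • br i j x y
  br_add_right : ∀ i j (x : V i) (y y' : V j), br i j x (y + y') = br i j x y + br i j x y'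
  br_smul_right : ∀ i j (c : ℂ) (x : V i) (y : V j), br i j x (c • y) = c • br i j x y
  d_sq : ∀ i (x : V i), d (i + 1) (d i x) = 0
  antisym : ∀ i j (x : V i) (y : V j),
    br i j x y = - toGLD.tr (by omega) (((Int.negOnePow (i * j) : ℤˣ) : ℤ) • br j i y x)
  leibniz : ∀ i j (x : V i) (y : V j),
    d (i + j) (br i j x y) =
      toGLD.tr (by omega) (br (i + 1) j (d i x) y) +
        ((Int.negOnePow i : ℤˣ) : ℤ) • toGLD.tr (by omega) (br i (j + 1) x (d j y))
  jacobi : ∀ i j k (x : V i) (y : V j) (z : V k),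
    br i (j + k) x (br j k y z) =
      toGLD.tr (by omega) (br (i + j) k (br i j x y) z) +
        ((Int.negOnePow (i * j) : ℤˣ) : ℤ) • toGLD.tr (by omega) (br j (i + k) y (br i k x z))

namespace DGLA

/-- The differential as a linear map. -/
def dLin (L : DGLA) (i : ℤ) : L.V i →ₗ[ℂ] L.V (i + 1) :=
  { toFun := L.d i, map_add' := L.d_add i, map_smul' := L.d_smul i }

/-- The bracket as a bilinear map. -/
def brLin (L : DGLA) (i j : ℤ) : L.V i →ₗ[ℂ] L.V j →ₗ[ℂ] L.V (i + j) :=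
  LinearMap.mk₂ ℂ (L.br i j) (L.br_add_left i j) (fun c x y => L.br_smul_left i j c x y)
    (L.br_add_right i j) (fun c x y => L.br_smul_right i j c x y)

end DGLA

/-- Morphism of (differential) graded Lie algebras (data-level). -/
structure GLDHom (L M : GLD) where
  f : ∀ i, L.V i → M.V i
  f_add : ∀ i (x y : L.V i), f i (x + y) = f i x + f i y
  f_smul : ∀ i (c : ℂ) (x : L.V i), f i (c • x) = c • f i x
  f_d : ∀ i (x : L.V i), f (i + 1) (L.d i x) = M.d i (f i x)
  f_br : ∀ i j (x : L.V i) (y : L.V j), f (i + j) (L.br i j x y) = M.br i j (f i x) (f j y)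

/-- The components of a morphism as linear maps. -/
def GLDHom.lin {L M : GLD} (h : GLDHom L M) (i : ℤ) : L.V i →ₗ[ℂ] M.V i :=
  { toFun := h.f i, map_add' := h.f_add i, map_smul' := h.f_smul i }

section ArtinBase

variable (A : Type) [CommRing A] [Algebra ℂ A] [IsLocalRing A]

/-- The maximal ideal of a local `ℂ`-algebra. -/
abbrev mA : Ideal A := IsLocalRing.maximalIdeal A

/-- Multiplication of the maximal ideal, as a `ℂ`-bilinear map. -/
def mMul : (mA A) →ₗ[ℂ] (mA A) →ₗ[ℂ] (mA A) :=
  LinearMap.mk₂ ℂ (fun x y => ⟨x.1 * y.1, Ideal.mul_mem_left _ _ y.2⟩)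
    (fun x x' y => by ext; simp [add_mul])
    (fun c x y => by ext; simp [smul_mul_assoc])
    (fun x y y' => by ext; simp [mul_add])
    (fun c x y => by ext; simp [mul_smul_comm])

/-- For a DGLA `L`, the graded Lie data on `L ⊗ m_A`. -/
def DGLA.ten (L : DGLA) : GLD where
  V i := L.V i ⊗[ℂ] (mA A)
  d i := fun x => LinearMap.rTensor (mA A) (L.dLin i) x
  br i j := fun x y =>
    TensorProduct.curry
      ((TensorProduct.map (TensorProduct.lift (L.brLin i j)) (TensorProduct.lift (mMul A)))
        ∘ₗ (TensorProduct.tensorTensorTensorComm ℂ (L.V i) (mA A) (L.V j) (mA A)).toLinearMap)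
      x y

end ArtinBase
namespace GLD

/-- Polynomial differential forms `W[t,dt]`:
in degree `n` an element is `(p, q)` representing `Σᵢ pᵢ tⁱ + Σᵢ qᵢ tⁱ dt`,
with `pᵢ ∈ W^n` and `qᵢ ∈ W^{n-1}`. -/
def tdt (W : GLD) : GLD where
  V n := (ℕ →₀ W.V n) × (ℕ →₀ W.V (n - 1))
  d n x :=
    (x.1.sum fun i v => Finsupp.single i (W.d n v),
      (x.2.sum fun i v => Finsupp.single i (W.tr (by omega) (W.d (n - 1) v))) +
        ((Int.negOnePow n : ℤˣ) : ℤ) •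
          x.1.sum fun i v => Finsupp.single (i - 1) ((i : ℂ) • W.tr (by omega) v))
  br n m x y :=
    (x.1.sum fun i v => y.1.sum fun j w => Finsupp.single (i + j) (W.br n m v w),
      (x.1.sum fun i v => y.2.sum fun j w =>
          Finsupp.single (i + j) (W.tr (by omega) (W.br n (m - 1) v w))) +
        ((Int.negOnePow m : ℤˣ) : ℤ) •
          x.2.sum fun i v => y.1.sum fun j w =>
            Finsupp.single (i + j) (W.tr (by omega) (W.br (n - 1) m v w)))

/-- Evaluation `e_a : W[t,dt] → W` at a point `a ∈ ℂ`. -/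
def evalT (W : GLD) (a : ℂ) (n : ℤ) (x : (W.tdt).V n) : W.V n :=
  x.1.sum fun i v => (a ^ i) • v

/-- The inclusion `W → W[t,dt]` of constant polynomials. -/
def constT (W : GLD) (n : ℤ) (v : W.V n) : (W.tdt).V n :=
  (Finsupp.single 0 v, 0)

/-- The integral operator `∫₀¹ : W[t,dt] → W` of degree `-1`. -/
def int01 (W : GLD) (n : ℤ) (x : (W.tdt).V n) : W.V (n - 1) :=
  x.2.sum fun i v => (((i : ℂ) + 1))⁻¹ • v

/-- The integral operator `∫₀ᵗ`, returning the polynomial primitive of the `dt`-part. -/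
def int0t (W : GLD) (n : ℤ) (x : (W.tdt).V n) : ℕ →₀ W.V (n - 1) :=
  x.2.sum fun i v => Finsupp.single (i + 1) ((((i : ℂ) + 1))⁻¹ • v)

/-- The standard homotopy `K(m(t,dt)) = t∫₀¹ m − ∫₀ᵗ m` on `W[t,dt]`, of degree `-1`. -/
def Ktdt (W : GLD) (n : ℤ) (x : (W.tdt).V n) : (W.tdt).V (n - 1) :=
  (Finsupp.single 1 (W.int01 n x) - W.int0t n x, 0)

/-- A degreewise map between graded objects is a quasi-isomorphism: elementwise,
it induces a bijection on cohomology in every degree. -/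
def IsQuasiIso (L M : GLD) (f : ∀ i, L.V i → M.V i) : Prop :=
  ∀ i : ℤ,
    (∀ x : M.V i, M.d i x = 0 →
      ∃ y : L.V i, L.d i y = 0 ∧ ∃ z : M.V (i - 1), x = f i y + M.tr (by omega) (M.d (i - 1) z)) ∧
    (∀ y : L.V i, L.d i y = 0 →
      (∃ z : M.V (i - 1), f i y = M.tr (by omega) (M.d (i - 1) z)) →
      ∃ w : L.V (i - 1), y = L.tr (by omega) (L.d (i - 1) w))

/-- Extension of a degreewise map to polynomial differential forms, coefficientwise. -/
def tdtMap {W W' : GLD} (f : ∀ i, W.V i → W'.V i) (n : ℤ) (x : (W.tdt).V n) : (W'.tdt).V n :=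
  (x.1.sum fun i v => Finsupp.single i (f n v),
   x.2.sum fun i v => Finsupp.single i (f (n - 1) v))

end GLD

namespace GLD

/-- Componentwise graded Lie data on a triple product. -/
def prod3 (X Y Z : GLD) : GLD where
  V i := X.V i × Y.V i × Z.V i
  d i w := (X.d i w.1, Y.d i w.2.1, Z.d i w.2.2)
  br i j w w' := (X.br i j w.1 w'.1, Y.br i j w.2.1 w'.2.1, Z.br i j w.2.2 w'.2.2)

/-- Componentwise graded Lie data on a quadruple product. -/
def prod4 (X Y Z W : GLD) : GLD where
  V i := X.V i × Y.V i × Z.V i × W.V i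
  d i w := (X.d i w.1, Y.d i w.2.1, Z.d i w.2.2.1, W.d i w.2.2.2)
  br i j w w' := (X.br i j w.1 w'.1, Y.br i j w.2.1 w'.2.1,
    Z.br i j w.2.2.1 w'.2.2.1, W.br i j w.2.2.2 w'.2.2.2)

/-- Substitution `t ↦ αt + β` (and accordingly `dt ↦ α·dt`) on polynomial
differential forms. -/
def affSub (W : GLD) (α β : ℂ) (n : ℤ) (x : (W.tdt).V n) : (W.tdt).V n :=
  (x.1.sum fun i v => ∑ k ∈ Finset.range (i + 1),
      Finsupp.single k (((i.choose k : ℂ) * α ^ k * β ^ (i - k)) • v),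
   x.2.sum fun i v => ∑ k ∈ Finset.range (i + 1),
      Finsupp.single k ((α * (i.choose k : ℂ) * α ^ k * β ^ (i - k)) • v))

end GLD

section S6

variable (L M N : DGLA) (h : GLDHom L.toGLD M.toGLD) (g : GLDHom N.toGLD M.toGLD)

/-- The ambient product `L × N × M[t,dt]`. -/
abbrev PH : GLD := GLD.prod3 L.toGLD N.toGLD (M.toGLD.tdt)

/-- The ambient product `L × N × M[t,dt] × M[s,ds]`. -/
abbrev PK : GLD := GLD.prod4 L.toGLD N.toGLD (M.toGLD.tdt) (M.toGLD.tdt)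

/-- The subset `H_{(h,g)} = {(l,n,m(t,dt)) : h(l) = e₁(m), g(n) = e₀(m)}` of
`L × N × M[t,dt]`. -/
def Hset (i : ℤ) : Set ((PH L M N).V i) :=
  {w | h.f i w.1 = M.toGLD.evalT 1 i w.2.2 ∧ g.f i w.2.1 = M.toGLD.evalT 0 i w.2.2}

/-- The subset `H = {(l,n,m₁,m₂) : h(l) = e₁(m₂), g(n) = e₀(m₁), e₁(m₁) = e₀(m₂)}` of
`L × N × M[t,dt] × M[s,ds]`. -/
def Kset (i : ℤ) : Set ((PK L M N).V i) :=
  {w | h.f i w.1 = M.toGLD.evalT 1 i w.2.2.2 ∧ g.f i w.2.1 = M.toGLD.evalT 0 i w.2.2.1 ∧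
    M.toGLD.evalT 1 i w.2.2.1 = M.toGLD.evalT 0 i w.2.2.2}

/-- The barycentric subdivision map
`(l, n, m(t,dt)) ↦ (l, n, m(t/2, dt), m((s+1)/2, ds))`. -/
def bary (i : ℤ) (w : (PH L M N).V i) : (PK L M N).V i :=
  (w.1, w.2.1, M.toGLD.affSub (2:ℂ)⁻¹ 0 i w.2.2, M.toGLD.affSub (2:ℂ)⁻¹ (2:ℂ)⁻¹ i w.2.2)

namespace GLD

open Polynomial

@[simp] theorem tr_rfl (W : GLD) {i : ℤ} (e : i = i) (x : W.V i) : W.tr e x = x := rfl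

@[simp] theorem tr_tr (W : GLD) {i j k : ℤ} (e : i = j) (e' : j = k) (x : W.V i) :
    W.tr e' (W.tr e x) = W.tr (e.trans e') x := by
  subst e e'; rfl

theorem tr_add (W : GLD) {i j : ℤ} (e : i = j) (x y : W.V i) :
    W.tr e (x + y) = W.tr e x + W.tr e y := by
  subst e; rfl

theorem tr_smul (W : GLD) {i j : ℤ} (e : i = j) (c : ℂ) (x : W.V i) :
    W.tr e (c • x) = c • W.tr e x := by
  subst e; rfl

theorem d_tr (W : GLD) {i j : ℤ} (e : i = j) (x : W.V i) :
    W.d j (W.tr e x) = W.tr (by omega) (W.d i x) := by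
  subst e; rfl

/-- Transport along an equality of degrees, as a linear map. -/
def trLin (W : GLD) {i j : ℤ} (e : i = j) : W.V i →ₗ[ℂ] W.V j :=
  { toFun := W.tr e, map_add' := W.tr_add e, map_smul' := W.tr_smul e }

@[simp] theorem tr_zero (W : GLD) {i j : ℤ} (e : i = j) : W.tr e 0 = 0 := map_zero (W.trLin e)

/-- The `A`-valued polynomial `P(t) v` attached to a polynomial `P` and a vector `v : A`. -/
def polyVec (A : Type) [AddCommGroup A] [Module ℂ A] : ℂ[X] →ₗ[ℂ] A →ₗ[ℂ] (ℕ →₀ A) :=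
  LinearMap.mk₂ ℂ (fun P v => P.sum fun k c => Finsupp.single k (c • v))
    (fun P Q v => Polynomial.sum_add_index P Q _ (by simp) (by simp [add_smul]))
    (fun c P v => by
      rw [Polynomial.sum_smul_index P c _ (by simp)]
      simp [Polynomial.sum_def, Finset.smul_sum, mul_smul])
    (fun P v w => by simp [Polynomial.sum_def, Finset.sum_add_distrib])
    (fun c P v => by simp [Polynomial.sum_def, Finset.smul_sum, smul_comm c])

theorem polyVec_monomial {A : Type} [AddCommGroup A] [Module ℂ A] (k : ℕ) (c : ℂ) (v : A) :
    polyVec A (monomial k c) v = Finsupp.single k (c • v) :=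
  Polynomial.sum_monomial_index c (fun k c => Finsupp.single k (c • v)) (by simp)

/-- The linear substitution `tⁱ ↦ Σₖ c i k tᵏ` on `A`-valued polynomials. -/
def substVec (A : Type) [AddCommGroup A] [Module ℂ A] (c : ℕ → ℕ → ℂ) :
    (ℕ →₀ A) →ₗ[ℂ] (ℕ →₀ A) where
  toFun x := x.sum fun i v => ∑ k ∈ Finset.range (i + 1), Finsupp.single k (c i k • v)
  map_add' x y := Finsupp.sum_add_index' (by simp) (by simp [Finset.sum_add_distrib])
  map_smul' a x := by
    rw [Finsupp.sum_smul_index' (by simp)]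
    simp [Finsupp.smul_sum, Finset.smul_sum, smul_comm a]

theorem substVec_single {A : Type} [AddCommGroup A] [Module ℂ A] (c : ℕ → ℕ → ℂ) (i : ℕ) (v : A) :
    substVec A c (Finsupp.single i v) =
      ∑ k ∈ Finset.range (i + 1), Finsupp.single k (c i k • v) :=
  Finsupp.sum_single_index (h := fun i v => ∑ k ∈ Finset.range (i + 1),
    Finsupp.single k (c i k • v)) (by simp)

/-- Evaluation of `A`-valued polynomials at a point. -/
def evalVec (A : Type) [AddCommGroup A] [Module ℂ A] (a : ℂ) : (ℕ →₀ A) →ₗ[ℂ] A where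
  toFun x := x.sum fun i v => (a ^ i) • v
  map_add' x y := Finsupp.sum_add_index' (by simp) (by simp)
  map_smul' c x := by
    rw [Finsupp.sum_smul_index' (by simp)]
    simp [Finsupp.smul_sum, smul_comm c]

theorem evalVec_single {A : Type} [AddCommGroup A] [Module ℂ A] (a : ℂ) (i : ℕ) (v : A) :
    evalVec A a (Finsupp.single i v) = a ^ i • v :=
  Finsupp.sum_single_index (h := fun i v => (a ^ i) • v) (smul_zero _)

/-- The splitting of a polynomial differential form into its two parts. -/
def tdtEquiv (W : GLD) (n : ℤ) :
    (W.tdt).V n ≃ₗ[ℂ] (ℕ →₀ W.V n) × (ℕ →₀ W.V (n - 1)) where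
  toFun x := x
  invFun x := x
  map_add' _ _ := rfl
  map_smul' _ _ := rfl
  left_inv _ := rfl
  right_inv _ := rfl

/-- The form `P(t) v` without `dt`-part attached to a polynomial `P` and a vector `v`. -/
def polyFun (W : GLD) (n : ℤ) : ℂ[X] →ₗ[ℂ] W.V n →ₗ[ℂ] (W.tdt).V n :=
  (polyVec (W.V n)).compr₂ ((W.tdtEquiv n).symm.toLinearMap ∘ₗ LinearMap.inl ℂ _ _)

/-- The form `P(t) v dt` attached to a polynomial `P` and a vector `v`. -/
def polyForm (W : GLD) (n : ℤ) : ℂ[X] →ₗ[ℂ] W.V (n - 1) →ₗ[ℂ] (W.tdt).V n :=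
  (polyVec (W.V (n - 1))).compr₂ ((W.tdtEquiv n).symm.toLinearMap ∘ₗ LinearMap.inr ℂ _ _)

theorem polyFun_monomial (W : GLD) (n : ℤ) (k : ℕ) (c : ℂ) (v : W.V n) :
    W.polyFun n (monomial k c) v = (Finsupp.single k (c • v), 0) :=
  congrArg (fun a => (W.tdtEquiv n).symm (a, 0)) (polyVec_monomial k c v)

theorem polyForm_monomial (W : GLD) (n : ℤ) (k : ℕ) (c : ℂ) (v : W.V (n - 1)) :
    W.polyForm n (monomial k c) v = (0, Finsupp.single k (c • v)) :=
  congrArg (fun a => (W.tdtEquiv n).symm (0, a)) (polyVec_monomial k c v)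

theorem polyFun_X_pow (W : GLD) (n : ℤ) (k : ℕ) (v : W.V n) :
    W.polyFun n (X ^ k) v = (Finsupp.single k v, 0) := by
  rw [X_pow_eq_monomial, polyFun_monomial, one_smul]

theorem polyForm_X_pow (W : GLD) (n : ℤ) (k : ℕ) (v : W.V (n - 1)) :
    W.polyForm n (X ^ k) v = (0, Finsupp.single k v) := by
  rw [X_pow_eq_monomial, polyForm_monomial, one_smul]

/-- Polynomial differential forms are spanned by the `tᵏ v` and the `tᵏ v dt`. -/
theorem tdt_induction (W : GLD) {n : ℤ} {p : (W.tdt).V n → Prop} (x : (W.tdt).V n)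
    (add : ∀ x y, p x → p y → p (x + y))
    (funs : ∀ (k : ℕ) v, p (W.polyFun n (X ^ k) v))
    (forms : ∀ (k : ℕ) v, p (W.polyForm n (X ^ k) v)) : p x := by
  have zero : p 0 := by simpa using funs 0 0
  have h₁ : ∀ a : ℕ →₀ W.V n, p ((W.tdtEquiv n).symm (a, 0)) := fun a => by
    induction a using Finsupp.induction_linear with
    | zero => exact zero
    | add a b ha hb =>
      have := add _ _ ha hb
      rwa [← map_add, Prod.mk_add_mk, add_zero] at this
    | single k v => exact W.polyFun_X_pow n k v ▸ funs k v
  have h₂ : ∀ a : ℕ →₀ W.V (n - 1), p ((W.tdtEquiv n).symm (0, a)) := fun a => by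
    induction a using Finsupp.induction_linear with
    | zero => exact zero
    | add a b ha hb =>
      have := add _ _ ha hb
      rwa [← map_add, Prod.mk_add_mk, add_zero] at this
    | single k v => exact W.polyForm_X_pow n k v ▸ forms k v
  have := add _ _ (h₁ x.1) (h₂ x.2)
  rwa [← map_add, Prod.mk_add_mk, add_zero, zero_add] at this

/-- Evaluation of polynomial differential forms, as a linear map. -/
def evalLin (W : GLD) (a : ℂ) (n : ℤ) : (W.tdt).V n →ₗ[ℂ] W.V n where
  toFun := W.evalT a n
  map_add' x y := (evalVec (W.V n) a).map_add x.1 y.1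
  map_smul' c x := (evalVec (W.V n) a).map_smul c x.1

@[simp] theorem evalLin_polyFun (W : GLD) (a : ℂ) (n : ℤ) (P : ℂ[X]) (v : W.V n) :
    W.evalLin a n (W.polyFun n P v) = P.eval a • v := by
  induction P using Polynomial.induction_on' with
  | add P Q hP hQ => simp [hP, hQ, add_smul]
  | monomial k c =>
    rw [polyFun_monomial, eval_monomial, mul_comm, mul_smul]
    exact evalVec_single a k (c • v)

@[simp] theorem evalLin_polyForm (W : GLD) (a : ℂ) (n : ℤ) (P : ℂ[X]) (v : W.V (n - 1)) :
    W.evalLin a n (W.polyForm n P v) = 0 :=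
  (evalVec (W.V n) a).map_zero

/-- Affine substitution in polynomial differential forms, as a linear map. -/
def affLin (W : GLD) (α β : ℂ) (n : ℤ) : (W.tdt).V n →ₗ[ℂ] (W.tdt).V n where
  toFun := W.affSub α β n
  map_add' x y := Prod.ext
    ((substVec _ fun i k => (i.choose k : ℂ) * α ^ k * β ^ (i - k)).map_add x.1 y.1)
    ((substVec _ fun i k => α * (i.choose k : ℂ) * α ^ k * β ^ (i - k)).map_add x.2 y.2)
  map_smul' c x := Prod.ext
    ((substVec _ fun i k => (i.choose k : ℂ) * α ^ k * β ^ (i - k)).map_smul c x.1)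
    ((substVec _ fun i k => α * (i.choose k : ℂ) * α ^ k * β ^ (i - k)).map_smul c x.2)

theorem X_pow_comp_affine (α β : ℂ) (k : ℕ) :
    (X ^ k : ℂ[X]).comp (C α * X + C β) =
      ∑ j ∈ Finset.range (k + 1), monomial j ((k.choose j : ℂ) * α ^ j * β ^ (k - j)) := by
  rw [X_pow_comp, add_pow]
  refine Finset.sum_congr rfl fun j _ => ?_
  rw [← C_mul_X_pow_eq_monomial]
  simp only [C_mul, C_pow, mul_pow, C_eq_natCast]
  ring

theorem polyVec_comp_affine {A : Type} [AddCommGroup A] [Module ℂ A] (γ α β : ℂ) (k : ℕ)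
    (v : A) :
    polyVec A (γ • (X ^ k : ℂ[X]).comp (C α * X + C β)) v =
      ∑ j ∈ Finset.range (k + 1),
        Finsupp.single j ((γ * (k.choose j : ℂ) * α ^ j * β ^ (k - j)) • v) := by
  simp only [X_pow_comp_affine, Finset.smul_sum, smul_monomial, smul_eq_mul, map_sum,
    LinearMap.sum_apply, polyVec_monomial, mul_assoc]

theorem affLin_polyFun_X_pow (W : GLD) (α β : ℂ) (n : ℤ) (k : ℕ) (v : W.V n) :
    W.affLin α β n (W.polyFun n (X ^ k) v) =
      W.polyFun n ((X ^ k : ℂ[X]).comp (C α * X + C β)) v := by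
  rw [polyFun_X_pow]
  refine Prod.ext ?_
    (map_zero (substVec _ fun i k => α * (i.choose k : ℂ) * α ^ k * β ^ (i - k)))
  refine (substVec_single (fun i k => (i.choose k : ℂ) * α ^ k * β ^ (i - k)) k v).trans ?_
  have key := polyVec_comp_affine 1 α β k v
  simp only [one_mul, one_smul] at key
  exact key.symm

theorem affLin_polyForm_X_pow (W : GLD) (α β : ℂ) (n : ℤ) (k : ℕ) (v : W.V (n - 1)) :
    W.affLin α β n (W.polyForm n (X ^ k) v) =
      W.polyForm n (α • (X ^ k : ℂ[X]).comp (C α * X + C β)) v := by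
  rw [polyForm_X_pow]
  refine Prod.ext
    (map_zero (substVec _ fun i k => (i.choose k : ℂ) * α ^ k * β ^ (i - k))) ?_
  refine (substVec_single (fun i k => α * (i.choose k : ℂ) * α ^ k * β ^ (i - k)) k v).trans ?_
  exact (polyVec_comp_affine α α β k v).symm

@[simp] theorem affLin_polyFun (W : GLD) (α β : ℂ) (n : ℤ) (P : ℂ[X]) (v : W.V n) :
    W.affLin α β n (W.polyFun n P v) = W.polyFun n (P.comp (C α * X + C β)) v := by
  induction P using Polynomial.induction_on' with
  | add P Q hP hQ => simp only [map_add, LinearMap.add_apply, hP, hQ, add_comp]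
  | monomial k c =>
    rw [← C_mul_X_pow_eq_monomial, ← smul_eq_C_mul, smul_comp]
    simp only [map_smul, LinearMap.smul_apply, affLin_polyFun_X_pow]

@[simp] theorem affLin_polyForm (W : GLD) (α β : ℂ) (n : ℤ) (P : ℂ[X]) (v : W.V (n - 1)) :
    W.affLin α β n (W.polyForm n P v) = W.polyForm n (α • P.comp (C α * X + C β)) v := by
  induction P using Polynomial.induction_on' with
  | add P Q hP hQ => simp only [map_add, LinearMap.add_apply, hP, hQ, add_comp, smul_add]
  | monomial k c =>
    rw [← C_mul_X_pow_eq_monomial, ← smul_eq_C_mul, smul_comp, smul_comm α c]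
    simp only [map_smul, LinearMap.smul_apply, affLin_polyForm_X_pow]

theorem evalLin_affLin (W : GLD) (a α β : ℂ) (n : ℤ) (x : (W.tdt).V n) :
    W.evalLin a n (W.affLin α β n x) = W.evalLin (α * a + β) n x := by
  induction x using W.tdt_induction with
  | add x y hx hy => simp only [map_add, hx, hy]
  | funs k v => simp
  | forms k v => simp

theorem affLin_injective (W : GLD) {α : ℂ} (hα : α ≠ 0) (β : ℂ) (n : ℤ) :
    Function.Injective (W.affLin α β n) := by
  refine Function.LeftInverse.injective (g := W.affLin α⁻¹ (-(α⁻¹ * β)) n) fun x => ?_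
  have key : (C α * X + C β : ℂ[X]).comp (C α⁻¹ * X + C (-(α⁻¹ * β))) = X := by
    simp only [add_comp, mul_comp, C_comp, X_comp, mul_add, ← mul_assoc, ← C_mul, add_assoc,
      ← C_add]
    simp [hα]
  induction x using W.tdt_induction with
  | add x y hx hy => simp only [map_add, hx, hy]
  | funs k v => simp only [affLin_polyFun, comp_assoc, key, comp_X]
  | forms k v =>
    simp only [affLin_polyForm, smul_comp, comp_assoc, key, comp_X, smul_smul,
      inv_mul_cancel₀ hα, one_smul]

/-- The linear map `Σ vᵢ tⁱ ↦ Σ f i vᵢ t^(ρ i)` on vector-valued polynomials. -/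
def mapVec {A B : Type} [AddCommGroup A] [Module ℂ A] [AddCommGroup B] [Module ℂ B]
    (ρ : ℕ → ℕ) (f : ℕ → A →ₗ[ℂ] B) : (ℕ →₀ A) →ₗ[ℂ] (ℕ →₀ B) where
  toFun x := x.sum fun i v => Finsupp.single (ρ i) (f i v)
  map_add' x y := Finsupp.sum_add_index' (by simp) (by simp)
  map_smul' c x := by
    rw [Finsupp.sum_smul_index' (by simp)]
    simp [Finsupp.smul_sum]

theorem mapVec_single {A B : Type} [AddCommGroup A] [Module ℂ A] [AddCommGroup B] [Module ℂ B]
    (ρ : ℕ → ℕ) (f : ℕ → A →ₗ[ℂ] B) (i : ℕ) (v : A) :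
    mapVec ρ f (Finsupp.single i v) = Finsupp.single (ρ i) (f i v) :=
  Finsupp.sum_single_index (h := fun i v => Finsupp.single (ρ i) (f i v)) (by simp)

/-- The extension of a bilinear map to vector-valued polynomials. -/
def mulVec {A B E : Type} [AddCommGroup A] [Module ℂ A] [AddCommGroup B] [Module ℂ B]
    [AddCommGroup E] [Module ℂ E] (f : A →ₗ[ℂ] B →ₗ[ℂ] E) :
    (ℕ →₀ A) →ₗ[ℂ] (ℕ →₀ B) →ₗ[ℂ] (ℕ →₀ E) :=
  LinearMap.mk₂ ℂ (fun x y => x.sum fun i v => y.sum fun j w => Finsupp.single (i + j) (f v w))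
    (fun x x' y => Finsupp.sum_add_index' (by simp) (by simp))
    (fun c x y => by
      rw [Finsupp.sum_smul_index' (by simp)]
      simp [Finsupp.smul_sum])
    (fun x y y' => by
      rw [← Finsupp.sum_add]
      exact Finsupp.sum_congr fun i _ => Finsupp.sum_add_index' (by simp) (by simp))
    (fun c x y => by
      rw [Finsupp.smul_sum]
      refine Finsupp.sum_congr fun i _ => ?_
      rw [Finsupp.sum_smul_index' (by simp)]
      simp [Finsupp.smul_sum])

theorem mulVec_single {A B E : Type} [AddCommGroup A] [Module ℂ A] [AddCommGroup B] [Module ℂ B]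
    [AddCommGroup E] [Module ℂ E] (f : A →ₗ[ℂ] B →ₗ[ℂ] E) (i j : ℕ) (v : A) (w : B) :
    mulVec f (Finsupp.single i v) (Finsupp.single j w) = Finsupp.single (i + j) (f v w) := by
  rw [mulVec, LinearMap.mk₂_apply, Finsupp.sum_single_index (by simp),
    Finsupp.sum_single_index (by simp)]

theorem mulVec_polyVec {A B E : Type} [AddCommGroup A] [Module ℂ A] [AddCommGroup B] [Module ℂ B]
    [AddCommGroup E] [Module ℂ E] (f : A →ₗ[ℂ] B →ₗ[ℂ] E) (P Q : ℂ[X]) (v : A) (w : B) :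
    mulVec f (polyVec A P v) (polyVec B Q w) = polyVec E (P * Q) (f v w) := by
  induction P using Polynomial.induction_on' with
  | add P P' hP hP' => simp only [map_add, LinearMap.add_apply, hP, hP', add_mul]
  | monomial k c =>
    induction Q using Polynomial.induction_on' with
    | add Q Q' hQ hQ' => simp only [map_add, LinearMap.add_apply, hQ, hQ', mul_add]
    | monomial l c' =>
      simp only [polyVec_monomial, mulVec_single, monomial_mul_monomial, map_smul,
        LinearMap.smul_apply, smul_smul, mul_comm c']

end GLD

namespace DGLA

open Polynomial

/-- The differential of `D[t,dt]`, as a linear map. -/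
def tdtD (D : DGLA) (n : ℤ) : (D.tdt).V n →ₗ[ℂ] (D.tdt).V (n + 1) :=
  (D.tdtEquiv (n + 1)).symm.toLinearMap ∘ₗ
    LinearMap.prod (GLD.mapVec id (fun _ => D.dLin n) ∘ₗ LinearMap.fst ℂ _ _)
      (GLD.mapVec id (fun _ => D.trLin (j := n + 1 - 1) (by omega) ∘ₗ D.dLin (n - 1)) ∘ₗ
          LinearMap.snd ℂ _ _ +
        ((Int.negOnePow n : ℤˣ) : ℤ) •
          (GLD.mapVec (· - 1)
              (fun i => (i : ℂ) • D.trLin (i := n) (j := n + 1 - 1) (by omega)) ∘ₗ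
            LinearMap.fst ℂ _ _)) ∘ₗ
    (D.tdtEquiv n).toLinearMap

theorem tdtD_polyFun_X_pow (D : DGLA) (n : ℤ) (k : ℕ) (v : D.V n) :
    D.tdtD n (D.polyFun n (X ^ k) v) = D.polyFun (n + 1) (X ^ k) (D.d n v) +
      ((Int.negOnePow n : ℤˣ) : ℤ) •
        D.polyForm (n + 1) (derivative (X ^ k)) (D.tr (by omega) v) := by
  rw [derivative_X_pow, C_mul_X_pow_eq_monomial, D.polyFun_X_pow, D.polyFun_X_pow,
    D.polyForm_monomial]
  refine Prod.ext ?_ ?_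
  · refine (GLD.mapVec_single id (fun _ => D.dLin n) k v).trans (.symm ?_)
    exact (congrArg (Finsupp.single k (D.d n v) + ·) (smul_zero _)).trans (add_zero _)
  · refine (congrArg₂ (· + ·)
      (map_zero (GLD.mapVec id fun _ => D.trLin (j := n + 1 - 1) (by omega) ∘ₗ D.dLin (n - 1)))
      (congrArg (((Int.negOnePow n : ℤˣ) : ℤ) • ·)
        (GLD.mapVec_single (· - 1)
          (fun i => (i : ℂ) • D.trLin (i := n) (j := n + 1 - 1) (by omega)) k v))).trans ?_
    rfl

theorem tdtD_polyForm_X_pow (D : DGLA) (n : ℤ) (k : ℕ) (v : D.V (n - 1)) :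
    D.tdtD n (D.polyForm n (X ^ k) v) =
      D.polyForm (n + 1) (X ^ k) (D.tr (by omega) (D.d (n - 1) v)) := by
  rw [D.polyForm_X_pow, D.polyForm_X_pow]
  refine Prod.ext (map_zero (GLD.mapVec id fun _ => D.dLin n)) ?_
  refine (congrArg₂ (· + ·)
      (GLD.mapVec_single id (fun _ => D.trLin (j := n + 1 - 1) (by omega) ∘ₗ D.dLin (n - 1)) k v)
      (congrArg (((Int.negOnePow n : ℤˣ) : ℤ) • ·)
        (map_zero (GLD.mapVec (· - 1)
          (fun i => (i : ℂ) • D.trLin (i := n) (j := n + 1 - 1) (by omega)))))).trans ?_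
  exact (congrArg (_ + ·) (smul_zero _)).trans (add_zero _)

@[simp] theorem tdtD_polyFun (D : DGLA) (n : ℤ) (P : ℂ[X]) (v : D.V n) :
    D.tdtD n (D.polyFun n P v) = D.polyFun (n + 1) P (D.d n v) +
      ((Int.negOnePow n : ℤˣ) : ℤ) • D.polyForm (n + 1) (derivative P) (D.tr (by omega) v) := by
  induction P using Polynomial.induction_on' with
  | add P Q hP hQ =>
    simp only [map_add, LinearMap.add_apply, hP, hQ, smul_add]
    abel
  | monomial k c =>
    rw [← C_mul_X_pow_eq_monomial, ← smul_eq_C_mul]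
    simp only [map_smul, LinearMap.smul_apply, tdtD_polyFun_X_pow, smul_add, smul_comm c]

@[simp] theorem tdtD_polyForm (D : DGLA) (n : ℤ) (P : ℂ[X]) (v : D.V (n - 1)) :
    D.tdtD n (D.polyForm n P v) =
      D.polyForm (n + 1) P (D.tr (by omega) (D.d (n - 1) v)) := by
  induction P using Polynomial.induction_on' with
  | add P Q hP hQ => simp only [map_add, LinearMap.add_apply, hP, hQ]
  | monomial k c =>
    rw [← C_mul_X_pow_eq_monomial, ← smul_eq_C_mul]
    simp only [map_smul, LinearMap.smul_apply, tdtD_polyForm_X_pow]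

/-- The bracket of `D[t,dt]`, as a bilinear map. -/
def tdtBr (D : DGLA) (n m : ℤ) :
    (D.tdt).V n →ₗ[ℂ] (D.tdt).V m →ₗ[ℂ] (D.tdt).V (n + m) :=
  let F := (GLD.mulVec (D.brLin n m)).compl₁₂
    (LinearMap.fst ℂ _ (ℕ →₀ D.V (n - 1))) (LinearMap.fst ℂ _ (ℕ →₀ D.V (m - 1)))
  let G := (GLD.mulVec ((D.brLin n (m - 1)).compr₂ (D.trLin (j := n + m - 1) (by omega)))).compl₁₂
      (LinearMap.fst ℂ _ (ℕ →₀ D.V (n - 1))) (LinearMap.snd ℂ (ℕ →₀ D.V m) _) +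
    ((Int.negOnePow m : ℤˣ) : ℤ) •
      (GLD.mulVec ((D.brLin (n - 1) m).compr₂ (D.trLin (j := n + m - 1) (by omega)))).compl₁₂
        (LinearMap.snd ℂ (ℕ →₀ D.V n) _) (LinearMap.fst ℂ _ (ℕ →₀ D.V (m - 1)))
  LinearMap.mk₂ ℂ ((D.tdt).br n m)
    (fun x x' y => Prod.ext (F.map_add₂ x x' y) (G.map_add₂ x x' y))
    (fun c x y => Prod.ext (F.map_smul₂ c x y) (G.map_smul₂ c x y))
    (fun x y y' => Prod.ext ((F x).map_add y y') ((G x).map_add y y'))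
    (fun c x y => Prod.ext ((F x).map_smul c y) ((G x).map_smul c y))

@[simp] theorem tdtBr_polyFun_polyFun (D : DGLA) (n m : ℤ) (P Q : ℂ[X]) (v : D.V n) (w : D.V m) :
    D.tdtBr n m (D.polyFun n P v) (D.polyFun m Q w) =
      D.polyFun (n + m) (P * Q) (D.brLin n m v w) := by
  refine Prod.ext (GLD.mulVec_polyVec (D.brLin n m) P Q v w) ?_
  refine (congrArg₂ (· + ·) (map_zero (GLD.mulVec
    ((D.brLin n (m - 1)).compr₂ (D.trLin (j := n + m - 1) (by omega))) (GLD.polyVec _ P v)))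
    (congrArg (((Int.negOnePow m : ℤˣ) : ℤ) • ·) (LinearMap.map_zero₂ (GLD.mulVec
    ((D.brLin (n - 1) m).compr₂ (D.trLin (j := n + m - 1) (by omega)))) (GLD.polyVec _ Q w)))).trans
    ?_
  exact (congrArg (0 + ·) (smul_zero _)).trans (add_zero _)

@[simp] theorem tdtBr_polyFun_polyForm (D : DGLA) (n m : ℤ) (P Q : ℂ[X]) (v : D.V n)
    (w : D.V (m - 1)) :
    D.tdtBr n m (D.polyFun n P v) (D.polyForm m Q w) =
      D.polyForm (n + m) (P * Q) (D.tr (by omega) (D.brLin n (m - 1) v w)) := by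
  refine Prod.ext (map_zero (GLD.mulVec (D.brLin n m) _)) ?_
  refine (congrArg₂ (· + ·) (GLD.mulVec_polyVec
    ((D.brLin n (m - 1)).compr₂ (D.trLin (j := n + m - 1) (by omega))) P Q v w)
    (congrArg (((Int.negOnePow m : ℤˣ) : ℤ) • ·) (LinearMap.map_zero₂ (GLD.mulVec
    ((D.brLin (n - 1) m).compr₂ (D.trLin (j := n + m - 1) (by omega)))) (0 : ℕ →₀ D.V m)))).trans
    ?_
  exact (congrArg (_ + ·) (smul_zero _)).trans (add_zero _)

@[simp] theorem tdtBr_polyForm_polyFun (D : DGLA) (n m : ℤ) (P Q : ℂ[X]) (v : D.V (n - 1))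
    (w : D.V m) :
    D.tdtBr n m (D.polyForm n P v) (D.polyFun m Q w) =
      ((Int.negOnePow m : ℤˣ) : ℤ) •
        D.polyForm (n + m) (P * Q) (D.tr (by omega) (D.brLin (n - 1) m v w)) := by
  refine Prod.ext ((LinearMap.map_zero₂ (GLD.mulVec (D.brLin n m)) (GLD.polyVec _ Q w)).trans
    (smul_zero _).symm) ?_
  refine (congrArg₂ (· + ·) (map_zero (GLD.mulVec
    ((D.brLin n (m - 1)).compr₂ (D.trLin (j := n + m - 1) (by omega))) (0 : ℕ →₀ D.V n)))
    (congrArg (((Int.negOnePow m : ℤˣ) : ℤ) • ·) (GLD.mulVec_polyVec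
    ((D.brLin (n - 1) m).compr₂ (D.trLin (j := n + m - 1) (by omega))) P Q v w))).trans ?_
  exact zero_add _

@[simp] theorem tdtBr_polyForm_polyForm (D : DGLA) (n m : ℤ) (P Q : ℂ[X]) (v : D.V (n - 1))
    (w : D.V (m - 1)) :
    D.tdtBr n m (D.polyForm n P v) (D.polyForm m Q w) = 0 := by
  refine Prod.ext (LinearMap.map_zero₂ (GLD.mulVec (D.brLin n m)) (0 : ℕ →₀ D.V m)) ?_
  refine (congrArg₂ (· + ·) (LinearMap.map_zero₂ (GLD.mulVec
    ((D.brLin n (m - 1)).compr₂ (D.trLin (j := n + m - 1) (by omega)))) (GLD.polyVec _ Q w))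
    (congrArg (((Int.negOnePow m : ℤˣ) : ℤ) • ·) (map_zero (GLD.mulVec
    ((D.brLin (n - 1) m).compr₂ (D.trLin (j := n + m - 1) (by omega))) (GLD.polyVec _ P v))))).trans
    ?_
  exact (congrArg (0 + ·) (smul_zero _)).trans (add_zero _)

theorem d_zero (D : DGLA) (n : ℤ) : D.d n 0 = 0 := map_zero (D.dLin n)

theorem tdtD_tdtD (D : DGLA) (n : ℤ) (x : (D.tdt).V n) : D.tdtD (n + 1) (D.tdtD n x) = 0 := by
  induction x using D.tdt_induction with
  | add x y hx hy => simp only [map_add, hx, hy, add_zero]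
  | funs k v => simp [D.d_tr, D.d_sq, Int.negOnePow_succ]
  | forms k v => simp [D.d_tr, D.d_sq]

theorem evalLin_tdtD (D : DGLA) (a : ℂ) (n : ℤ) (x : (D.tdt).V n) :
    D.evalLin a (n + 1) (D.tdtD n x) = D.d n (D.evalLin a n x) := by
  induction x using D.tdt_induction with
  | add x y hx hy => simp only [map_add, hx, hy, D.d_add]
  | funs k v => simp [D.d_smul]
  | forms k v => simp [D.d_zero]

theorem evalLin_tdtBr (D : DGLA) (a : ℂ) (n m : ℤ) (x : (D.tdt).V n) (y : (D.tdt).V m) :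
    D.evalLin a (n + m) (D.tdtBr n m x y) =
      D.brLin n m (D.evalLin a n x) (D.evalLin a m y) := by
  induction x using D.tdt_induction with
  | add x x' hx hx' => simp only [map_add, LinearMap.add_apply, hx, hx']
  | funs k v =>
    induction y using D.tdt_induction with
    | add y y' hy hy' => simp only [map_add, hy, hy']
    | funs l w => simp [smul_smul, mul_comm]
    | forms l w => simp
  | forms k v =>
    induction y using D.tdt_induction with
    | add y y' hy hy' => simp only [map_add, hy, hy']
    | funs l w => simp
    | forms l w => simp

theorem affLin_tdtD (D : DGLA) (α β : ℂ) (n : ℤ) (x : (D.tdt).V n) :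
    D.affLin α β (n + 1) (D.tdtD n x) = D.tdtD n (D.affLin α β n x) := by
  induction x using D.tdt_induction with
  | add x y hx hy => simp only [map_add, hx, hy]
  | funs k v =>
    simp only [GLD.affLin_polyFun, GLD.affLin_polyForm, tdtD_polyFun, map_add, map_zsmul,
      derivative_comp]
    simp [smul_eq_C_mul, derivative_mul]
  | forms k v => simp

theorem affLin_tdtBr (D : DGLA) (α β : ℂ) (n m : ℤ) (x : (D.tdt).V n) (y : (D.tdt).V m) :
    D.affLin α β (n + m) (D.tdtBr n m x y) =
      D.tdtBr n m (D.affLin α β n x) (D.affLin α β m y) := by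
  induction x using D.tdt_induction with
  | add x x' hx hx' => simp only [map_add, LinearMap.add_apply, hx, hx']
  | funs k v =>
    induction y using D.tdt_induction with
    | add y y' hy hy' => simp only [map_add, hy, hy']
    | funs l w => simp only [tdtBr_polyFun_polyFun, GLD.affLin_polyFun, mul_comp]
    | forms l w =>
      simp only [tdtBr_polyFun_polyForm, GLD.affLin_polyFun, GLD.affLin_polyForm, mul_comp,
        mul_smul_comm]
  | forms k v =>
    induction y using D.tdt_induction with
    | add y y' hy hy' => simp only [map_add, hy, hy']
    | funs l w =>
      simp only [tdtBr_polyForm_polyFun, GLD.affLin_polyFun, GLD.affLin_polyForm, mul_comp,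
        smul_mul_assoc, map_zsmul]
    | forms l w => simp only [tdtBr_polyForm_polyForm, GLD.affLin_polyForm, map_zero]

theorem derivative_X_pow_succ_eq_smul (k : ℕ) :
    derivative (X ^ (k + 1) : ℂ[X]) = ((k : ℂ) + 1) • X ^ k := by
  rw [derivative_X_pow_succ, smul_eq_C_mul]

/-- The signed primitive `∫₀ᵗ` of polynomial differential forms, which lowers the degree. -/
def prim (D : DGLA) (n : ℤ) : (D.tdt).V (n + 1) →ₗ[ℂ] (D.tdt).V n :=
  ((Int.negOnePow n : ℤˣ) : ℤ) • ((D.tdtEquiv n).symm.toLinearMap ∘ₗ LinearMap.inl ℂ _ _ ∘ₗ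
    GLD.mapVec (· + 1) (fun i => ((i : ℂ) + 1)⁻¹ • D.trLin (by omega)) ∘ₗ
    LinearMap.snd ℂ _ _ ∘ₗ (D.tdtEquiv (n + 1)).toLinearMap)

@[simp] theorem prim_polyFun (D : DGLA) (n : ℤ) (P : ℂ[X]) (v : D.V (n + 1)) :
    D.prim n (D.polyFun (n + 1) P v) = 0 := by
  rw [prim, LinearMap.smul_apply]
  refine (congrArg (((Int.negOnePow n : ℤˣ) : ℤ) • ·) ?_).trans (smul_zero _)
  exact congrArg (fun a => (D.tdtEquiv n).symm (a, 0)) (map_zero (GLD.mapVec (· + 1)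
    (fun i => ((i : ℂ) + 1)⁻¹ • D.trLin (i := n + 1 - 1) (j := n) (by omega))))

@[simp] theorem prim_polyForm_X_pow (D : DGLA) (n : ℤ) (k : ℕ) (v : D.V (n + 1 - 1)) :
    D.prim n (D.polyForm (n + 1) (X ^ k) v) = ((Int.negOnePow n : ℤˣ) : ℤ) •
      D.polyFun n (X ^ (k + 1)) (((k : ℂ) + 1)⁻¹ • D.tr (by omega) v) := by
  rw [prim, LinearMap.smul_apply, D.polyForm_X_pow, D.polyFun_X_pow]
  exact congrArg (fun a => ((Int.negOnePow n : ℤˣ) : ℤ) • (D.tdtEquiv n).symm (a, 0))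
    (GLD.mapVec_single (· + 1)
      (fun i => ((i : ℂ) + 1)⁻¹ • D.trLin (i := n + 1 - 1) (j := n) (by omega)) k v)

theorem evalLin_zero_prim (D : DGLA) (n : ℤ) (x : (D.tdt).V (n + 1)) :
    D.evalLin 0 n (D.prim n x) = 0 := by
  induction x using D.tdt_induction with
  | add x y hx hy => simp only [map_add, hx, hy, add_zero]
  | funs k v => simp
  | forms k v => simp

/-- `prim` is a contracting homotopy of `D[t,dt]` onto its constants. -/
theorem tdtD_prim_add_prim_tdtD (D : DGLA) (n : ℤ) (x : (D.tdt).V (n + 1)) :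
    D.tdtD n (D.prim n x) + D.prim (n + 1) (D.tdtD (n + 1) x) =
      x - D.polyFun (n + 1) 1 (D.evalLin 0 (n + 1) x) := by
  induction x using D.tdt_induction with
  | add x y hx hy =>
    simp only [map_add]
    rw [add_add_add_comm, hx, hy]
    abel
  | funs k v =>
    cases k with
    | zero => simp
    | succ k =>
      have hk : (k : ℂ) + 1 ≠ 0 := Nat.cast_add_one_ne_zero k
      simp only [prim_polyFun, map_zero, zero_add, tdtD_polyFun, map_add, map_zsmul,
        derivative_X_pow_succ_eq_smul, map_smul, LinearMap.smul_apply, prim_polyForm_X_pow]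
      simp
      rw [smul_comm ((k : ℂ) + 1), smul_smul, Int.units_coe_mul_self, one_smul, smul_smul,
        mul_inv_cancel₀ hk, one_smul]
  | forms k v =>
    have hk : (k : ℂ) + 1 ≠ 0 := Nat.cast_add_one_ne_zero k
    simp only [prim_polyForm_X_pow, map_zsmul, tdtD_polyFun, tdtD_polyForm, map_smul, smul_add,
      derivative_X_pow_succ_eq_smul, LinearMap.smul_apply, D.d_tr,
      Int.negOnePow_succ]
    simp
    rw [smul_comm ((k : ℂ) + 1)⁻¹, smul_smul, Int.units_coe_mul_self, one_smul, smul_smul,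
      inv_mul_cancel₀ hk, one_smul]

/-- Every closed form is the sum of its value at `0` and an exact form. -/
theorem exists_tdtD_primitive (D : DGLA) (n : ℤ) (x : (D.tdt).V (n + 1))
    (hx : D.tdtD (n + 1) x = 0) : ∃ y : (D.tdt).V n, D.evalLin 0 n y = 0 ∧
      x = D.polyFun (n + 1) 1 (D.evalLin 0 (n + 1) x) + D.tdtD n y := by
  refine ⟨D.prim n x, D.evalLin_zero_prim n x, ?_⟩
  have key := D.tdtD_prim_add_prim_tdtD n x
  rw [hx, map_zero, add_zero] at key
  rw [key]
  abel

/-- The values at `0` and at `1` of a closed form are cohomologous. -/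
theorem exists_evalLin_one_eq (D : DGLA) (n : ℤ) (x : (D.tdt).V (n + 1))
    (hx : D.tdtD (n + 1) x = 0) :
    ∃ b : D.V n, D.evalLin 1 (n + 1) x = D.evalLin 0 (n + 1) x + D.d n b := by
  obtain ⟨y, -, hy⟩ := D.exists_tdtD_primitive n x hx
  refine ⟨D.evalLin 1 n y, ?_⟩
  have key := congrArg (D.evalLin 1 (n + 1)) hy
  rwa [map_add, GLD.evalLin_polyFun, eval_one, one_smul, evalLin_tdtD] at key

theorem tdtD_polyFun_one (D : DGLA) (n : ℤ) (v : D.V n) :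
    D.tdtD n (D.polyFun n 1 v) = D.polyFun (n + 1) 1 (D.d n v) := by
  simp

end DGLA

open Polynomial in
theorem bary_surjective_on_cohomology (j : ℤ) (w : (PK L M N).V (j + 1))
    (hw : w ∈ Kset L M N h g (j + 1)) (hdw : (PK L M N).d (j + 1) w = 0) :
    ∃ u ∈ Hset L M N h g (j + 1), (PH L M N).d (j + 1) u = 0 ∧
      ∃ z ∈ Kset L M N h g j, w = bary L M N (j + 1) u + (PK L M N).d j z := by
  obtain ⟨l, n, m₁, m₂⟩ := w
  obtain ⟨h₁, h₂, h₃⟩ := hw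
  have hl : L.d (j + 1) l = 0 := congrArg Prod.fst hdw
  have hn : N.d (j + 1) n = 0 := congrArg (fun w => w.2.1) hdw
  have hm₁ : M.tdtD (j + 1) m₁ = 0 := congrArg (fun w => w.2.2.1) hdw
  have hm₂ : M.tdtD (j + 1) m₂ = 0 := congrArg (fun w => w.2.2.2) hdw
  change h.f _ l = M.evalLin 1 _ m₂ at h₁
  change g.f _ n = M.evalLin 0 _ m₁ at h₂
  change M.evalLin 1 _ m₁ = M.evalLin 0 _ m₂ at h₃
  obtain ⟨A₁, hA₁, e₁⟩ := M.exists_tdtD_primitive j m₁ hm₁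
  obtain ⟨A₂, hA₂, e₂⟩ := M.exists_tdtD_primitive j m₂ hm₂
  obtain ⟨c, hc₀⟩ : ∃ c, M.evalLin 0 (j + 1) m₁ = c := ⟨_, rfl⟩
  rw [hc₀] at e₁ h₂
  have hc : M.d (j + 1) c = 0 := by rw [← hc₀, ← M.evalLin_tdtD, hm₁, map_zero]
  have hc₁ : M.evalLin 0 (j + 1) m₂ = c + M.d j (M.evalLin 1 j A₁) := by
    rw [← h₃, e₁, map_add, GLD.evalLin_polyFun, eval_one, one_smul, M.evalLin_tdtD]
  set a := M.evalLin 1 j A₁ + M.evalLin 1 j A₂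
  set T := M.polyFun j X a
  have hh : h.f _ l = c + M.d j a := by
    rw [h₁, e₂, map_add, GLD.evalLin_polyFun, eval_one, one_smul, M.evalLin_tdtD, hc₁, add_assoc,
      ← M.d_add]
  refine ⟨(l, n, M.polyFun (j + 1) 1 c + M.tdtD j T), ⟨?_, ?_⟩, ?_,
    (0, 0, A₁ - M.affLin 2⁻¹ 0 j T,
      A₂ + M.polyFun j 1 (M.evalLin 1 j A₁) - M.affLin 2⁻¹ 2⁻¹ j T), ⟨?_, ?_, ?_⟩, ?_⟩
  · change h.f _ l = M.evalLin 1 _ _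
    rw [hh, map_add, M.evalLin_tdtD]
    simp [T]
  · change g.f _ n = M.evalLin 0 _ _
    rw [h₂, map_add, M.evalLin_tdtD]
    simp [T, M.d_zero]
  · refine Prod.ext hl (Prod.ext hn ?_)
    change M.tdtD (j + 1) (M.polyFun (j + 1) 1 c + M.tdtD j T) = 0
    rw [map_add, M.tdtD_tdtD, M.tdtD_polyFun_one, hc, map_zero, add_zero]
  · change h.lin _ 0 = M.evalLin 1 _ _
    rw [map_zero, map_sub, map_add, GLD.evalLin_affLin]
    norm_num [T, a]
    abel
  · change g.lin _ 0 = M.evalLin 0 _ _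
    rw [map_zero, map_sub, GLD.evalLin_affLin, hA₁]
    simp [T]
  · change M.evalLin 1 _ _ = M.evalLin 0 _ _
    rw [map_sub, map_sub, map_add, GLD.evalLin_affLin, GLD.evalLin_affLin, hA₂]
    simp
  · have hl₀ : l = l + L.d j 0 := by rw [L.d_zero, add_zero]
    have hn₀ : n = n + N.d j 0 := by rw [N.d_zero, add_zero]
    have q₁ : m₁ = M.affLin 2⁻¹ 0 (j + 1) (M.polyFun (j + 1) 1 c + M.tdtD j T) +
        M.tdtD j (A₁ - M.affLin 2⁻¹ 0 j T) := by
      rw [map_add, map_sub, M.affLin_tdtD, GLD.affLin_polyFun, one_comp]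
      refine e₁.trans ?_
      abel
    have q₂ : m₂ = M.affLin 2⁻¹ 2⁻¹ (j + 1) (M.polyFun (j + 1) 1 c + M.tdtD j T) +
        M.tdtD j (A₂ + M.polyFun j 1 (M.evalLin 1 j A₁) - M.affLin 2⁻¹ 2⁻¹ j T) := by
      rw [map_add, map_sub, map_add, M.affLin_tdtD, GLD.affLin_polyFun, one_comp,
        M.tdtD_polyFun_one]
      refine e₂.trans ?_
      rw [hc₁, map_add]
      abel
    exact Prod.ext hl₀ (Prod.ext hn₀ (Prod.ext q₁ q₂))

open Polynomial in
theorem bary_injective_on_cohomology (k : ℤ) (u : (PH L M N).V (k + 1 + 1))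
    (hu : u ∈ Hset L M N h g (k + 1 + 1)) (hdu : (PH L M N).d (k + 1 + 1) u = 0)
    (z : (PK L M N).V (k + 1)) (hz : z ∈ Kset L M N h g (k + 1))
    (huz : bary L M N (k + 1 + 1) u = (PK L M N).d (k + 1) z) :
    ∃ v ∈ Hset L M N h g (k + 1), u = (PH L M N).d (k + 1) v := by
  obtain ⟨l, n, m⟩ := u
  obtain ⟨l', n', z₁, z₂⟩ := z
  obtain ⟨-, hg⟩ := hu
  obtain ⟨h₁, h₂, h₃⟩ := hz
  have hl : l = L.d (k + 1) l' := congrArg Prod.fst huz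
  have hn : n = N.d (k + 1) n' := congrArg (fun w => w.2.1) huz
  have hm₁ : M.affLin 2⁻¹ 0 _ m = M.tdtD (k + 1) z₁ := congrArg (fun w => w.2.2.1) huz
  have hm₂ : M.affLin 2⁻¹ 2⁻¹ _ m = M.tdtD (k + 1) z₂ := congrArg (fun w => w.2.2.2) huz
  have hm : M.tdtD (k + 1 + 1) m = 0 := congrArg (fun w => w.2.2) hdu
  change g.f _ n = M.evalLin 0 _ m at hg
  change h.f _ l' = M.evalLin 1 _ z₂ at h₁
  change g.f _ n' = M.evalLin 0 _ z₁ at h₂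
  change M.evalLin 1 _ z₁ = M.evalLin 0 _ z₂ at h₃
  obtain ⟨A, hA, e⟩ := M.exists_tdtD_primitive (k + 1) m hm
  set p := M.polyFun (k + 1) 1 (g.f _ n') + A with hp
  have hp₀ : M.evalLin 0 _ p = g.f _ n' := by simp [hp, hA]
  have hdp : M.tdtD _ p = m := by
    rw [hp, map_add, M.tdtD_polyFun_one, ← g.f_d, ← hn, hg, ← e]
  obtain ⟨b₁, hb₁⟩ := M.exists_evalLin_one_eq k (z₁ - M.affLin 2⁻¹ 0 _ p) (by
    rw [map_sub, ← M.affLin_tdtD, hdp, hm₁, sub_self])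
  obtain ⟨b₂, hb₂⟩ := M.exists_evalLin_one_eq k (z₂ - M.affLin 2⁻¹ 2⁻¹ _ p) (by
    rw [map_sub, ← M.affLin_tdtD, hdp, hm₂, sub_self])
  have hhalf : (2⁻¹ + 2⁻¹ : ℂ) = 1 := by norm_num
  simp only [map_sub, GLD.evalLin_affLin, mul_one, mul_zero, add_zero, zero_add, hhalf, hp₀]
    at hb₁ hb₂
  rw [← h₂, sub_self, zero_add] at hb₁
  rw [← h₃, hb₁, ← M.d_add, ← h₁] at hb₂
  refine ⟨(l', n', p + M.tdtD k (M.polyFun k X (b₁ + b₂))), ⟨?_, ?_⟩,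
    Prod.ext hl (Prod.ext hn ?_)⟩
  · change h.f _ l' = M.evalLin 1 _ _
    rw [map_add, M.evalLin_tdtD, GLD.evalLin_polyFun, eval_X, one_smul, ← hb₂]
    abel
  · change g.f _ n' = M.evalLin 0 _ _
    rw [map_add, M.evalLin_tdtD, GLD.evalLin_polyFun, eval_X, zero_smul, M.d_zero, hp₀, add_zero]
  · change m = M.tdtD (k + 1) (p + M.tdtD k (M.polyFun k X (b₁ + b₂)))
    rw [map_add, M.tdtD_tdtD, hdp, add_zero]

/-- `H_{(h,g)}` is a differential graded Lie subalgebra of `L × N × M[t,dt]`, and the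
barycentric subdivision map `H_{(h,g)} → H ⊂ L × N × M[t,dt] × M[s,ds]` is an injective
quasi-isomorphism of DGLAs. -/
theorem statement6 :
    -- H is a graded subspace closed under the differential and the bracket
    (∀ i : ℤ, (0 : (PH L M N).V i) ∈ Hset L M N h g i) ∧
    (∀ (i : ℤ) (w w' : (PH L M N).V i), w ∈ Hset L M N h g i → w' ∈ Hset L M N h g i →
      w + w' ∈ Hset L M N h g i) ∧
    (∀ (i : ℤ) (c : ℂ) (w : (PH L M N).V i), w ∈ Hset L M N h g i →
      c • w ∈ Hset L M N h g i) ∧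
    (∀ (i : ℤ) (w : (PH L M N).V i), w ∈ Hset L M N h g i →
      (PH L M N).d i w ∈ Hset L M N h g (i + 1)) ∧
    (∀ (i j : ℤ) (w : (PH L M N).V i) (w' : (PH L M N).V j),
      w ∈ Hset L M N h g i → w' ∈ Hset L M N h g j →
      (PH L M N).br i j w w' ∈ Hset L M N h g (i + j)) ∧
    -- the barycentric subdivision is an injective morphism of DGLAs into H
    (∀ i : ℤ, Function.Injective (bary L M N i)) ∧
    (∀ (i : ℤ) (w w' : (PH L M N).V i),
      bary L M N i (w + w') = bary L M N i w + bary L M N i w') ∧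
    (∀ (i : ℤ) (c : ℂ) (w : (PH L M N).V i), bary L M N i (c • w) = c • bary L M N i w) ∧
    (∀ (i : ℤ) (w : (PH L M N).V i),
      bary L M N (i + 1) ((PH L M N).d i w) = (PK L M N).d i (bary L M N i w)) ∧
    (∀ (i j : ℤ) (w : (PH L M N).V i) (w' : (PH L M N).V j),
      bary L M N (i + j) ((PH L M N).br i j w w') =
        (PK L M N).br i j (bary L M N i w) (bary L M N j w')) ∧
    (∀ (i : ℤ) (w : (PH L M N).V i), w ∈ Hset L M N h g i →
      bary L M N i w ∈ Kset L M N h g i) ∧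
    -- the barycentric subdivision is a quasi-isomorphism from H onto H'
    (∀ i : ℤ,
      (∀ w ∈ Kset L M N h g i, (PK L M N).d i w = 0 →
        ∃ u ∈ Hset L M N h g i, (PH L M N).d i u = 0 ∧
          ∃ z ∈ Kset L M N h g (i - 1),
            w = bary L M N i u +
              (PK L M N).tr (show (i-1)+1 = i by omega) ((PK L M N).d (i - 1) z)) ∧
      (∀ u ∈ Hset L M N h g i, (PH L M N).d i u = 0 →
        (∃ z ∈ Kset L M N h g (i - 1),
          bary L M N i u = (PK L M N).tr (show (i-1)+1 = i by omega) ((PK L M N).d (i - 1) z)) →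
        ∃ v ∈ Hset L M N h g (i - 1),
          u = (PH L M N).tr (show (i-1)+1 = i by omega) ((PH L M N).d (i - 1) v))) := by
  refine ⟨fun i => ⟨?_, ?_⟩, ?_, ?_, ?_, ?_, ?_, ?_, ?_, ?_, ?_, ?_, ?_⟩
  · exact (map_zero (h.lin i)).trans (map_zero (M.evalLin 1 i)).symm
  · exact (map_zero (g.lin i)).trans (map_zero (M.evalLin 0 i)).symm
  · rintro i w w' ⟨h₁, h₂⟩ ⟨h₁', h₂'⟩
    exact ⟨(h.f_add i _ _).trans
        ((congrArg₂ (· + ·) h₁ h₁').trans (map_add (M.evalLin 1 i) _ _).symm),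
      (g.f_add i _ _).trans
        ((congrArg₂ (· + ·) h₂ h₂').trans (map_add (M.evalLin 0 i) _ _).symm)⟩
  · rintro i c w ⟨h₁, h₂⟩
    exact ⟨(h.f_smul i c _).trans
        ((congrArg (c • ·) h₁).trans (map_smul (M.evalLin 1 i) c _).symm),
      (g.f_smul i c _).trans
        ((congrArg (c • ·) h₂).trans (map_smul (M.evalLin 0 i) c _).symm)⟩
  · rintro i w ⟨h₁, h₂⟩
    exact ⟨(h.f_d i _).trans ((congrArg (M.d i) h₁).trans (M.evalLin_tdtD 1 i _).symm),
      (g.f_d i _).trans ((congrArg (M.d i) h₂).trans (M.evalLin_tdtD 0 i _).symm)⟩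
  · rintro i j w w' ⟨h₁, h₂⟩ ⟨h₁', h₂'⟩
    exact ⟨(h.f_br i j _ _).trans
        ((congrArg₂ (M.br i j) h₁ h₁').trans (M.evalLin_tdtBr 1 i j _ _).symm),
      (g.f_br i j _ _).trans
        ((congrArg₂ (M.br i j) h₂ h₂').trans (M.evalLin_tdtBr 0 i j _ _).symm)⟩
  · intro i w w' hww'
    have h₁ : w.1 = w'.1 := congrArg (fun a : (PK L M N).V i => a.1) hww'
    have h₂ : w.2.1 = w'.2.1 := congrArg (fun a : (PK L M N).V i => a.2.1) hww'
    have h₃ : M.affLin 2⁻¹ 0 i w.2.2 = M.affLin 2⁻¹ 0 i w'.2.2 :=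
      congrArg (fun a : (PK L M N).V i => a.2.2.1) hww'
    exact Prod.ext h₁
      (Prod.ext h₂ (M.affLin_injective (inv_ne_zero two_ne_zero) 0 i h₃))
  · intro i w w'
    exact Prod.ext rfl (Prod.ext rfl (Prod.ext (map_add (M.affLin 2⁻¹ 0 i) w.2.2 w'.2.2)
      (map_add (M.affLin 2⁻¹ 2⁻¹ i) w.2.2 w'.2.2)))
  · intro i c w
    exact Prod.ext rfl (Prod.ext rfl (Prod.ext (map_smul (M.affLin 2⁻¹ 0 i) c w.2.2)
      (map_smul (M.affLin 2⁻¹ 2⁻¹ i) c w.2.2)))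
  · intro i w
    exact Prod.ext rfl (Prod.ext rfl (Prod.ext (M.affLin_tdtD 2⁻¹ 0 i w.2.2)
      (M.affLin_tdtD 2⁻¹ 2⁻¹ i w.2.2)))
  · intro i j w w'
    exact Prod.ext rfl (Prod.ext rfl (Prod.ext (M.affLin_tdtBr 2⁻¹ 0 i j w.2.2 w'.2.2)
      (M.affLin_tdtBr 2⁻¹ 2⁻¹ i j w.2.2 w'.2.2)))
  · rintro i w ⟨h₁, h₂⟩
    have hhalf : (2⁻¹ + 2⁻¹ : ℂ) = 1 := by norm_num
    refine ⟨h₁.trans ?_, h₂.trans ?_, ?_⟩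
    · change M.evalLin 1 i _ = M.evalLin 1 i (M.affLin _ _ _ _)
      rw [GLD.evalLin_affLin, mul_one, hhalf]
    · change M.evalLin 0 i _ = M.evalLin 0 i (M.affLin _ _ _ _)
      rw [GLD.evalLin_affLin, mul_zero, add_zero]
    · change M.evalLin 1 i (M.affLin _ _ _ _) = M.evalLin 0 i (M.affLin _ _ _ _)
      rw [GLD.evalLin_affLin, GLD.evalLin_affLin, mul_one, mul_zero, add_zero, zero_add]
  · intro i
    generalize_proofs e
    generalize i - 1 = j at e ⊢
    subst e
    refine ⟨bary_surjective_on_cohomology L M N h g j, fun u hu hdu ⟨z, hz, huz⟩ => ?_⟩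
    obtain ⟨k, rfl⟩ : ∃ k, j = k + 1 := ⟨j - 1, by omega⟩
    exact bary_injective_on_cohomology L M N h g k u hu hdu z hz huz

end S6
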